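/- The kG-module V₊ is cyclic, generated by ω_{0,0}: one has V₊ = kG·ω_{0,0}. -/

import Mathlib

noncomputable section

open scoped TensorProduct

namespace SL2X

variable (p : ℕ) [Fact p.Prime]

/-- The algebraic closure of the prime field `𝔽_p`. -/
abbrev F : Type := AlgebraicClosure (ZMod p)

/-- `G = SL₂(F)`. -/
abbrev G : Type := Matrix.SpecialLinearGroup (Fin 2) (F p)

/-- The unipotent element `ε(x) = [[1,x],[0,1]]`. -/
def eps (x : F p) : G p :=
  ⟨!![1, x; 0, 1], by simp [Matrix.det_fin_two_of]⟩

/-- The torus element `h(t) = diag(t, t⁻¹)`. -/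
def h (t : (F p)ˣ) : G p :=
  ⟨!![(t : F p), 0; 0, ((t⁻¹ : (F p)ˣ) : F p)], by simp [Matrix.det_fin_two_of]⟩

/-- The Weyl element `s = [[0,1],[-1,0]]`. -/
def sG : G p :=
  ⟨!![0, 1; -1, 0], by simp [Matrix.det_fin_two_of]⟩

/-- The Borel subgroup `B` of upper triangular matrices in `G`. -/
def B : Subgroup (G p) where
  carrier := {g | (g : Matrix (Fin 2) (Fin 2) (F p)) 1 0 = 0}
  one_mem' := by simp [Matrix.one_apply]
  mul_mem' := by
    intro a b ha hb
    simp only [Set.mem_setOf_eq] at *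
    simp [Matrix.mul_apply, Fin.sum_univ_two, ha, hb]
  inv_mem' := by
    intro a ha
    simp only [Set.mem_setOf_eq] at *
    simp [Matrix.SpecialLinearGroup.coe_inv, Matrix.adjugate_fin_two, ha]

/-- The diagonal part of an element of `B`, as a unit of `F`. -/
def Bdiag (b : B p) : (F p)ˣ where
  val := ((b : G p) : Matrix (Fin 2) (Fin 2) (F p)) 0 0
  inv := ((b : G p) : Matrix (Fin 2) (Fin 2) (F p)) 1 1
  val_inv := by
    have hdet : ((b : G p) : Matrix (Fin 2) (Fin 2) (F p)).det = 1 := (b : G p).2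
    have h10 : ((b : G p) : Matrix (Fin 2) (Fin 2) (F p)) 1 0 = 0 := b.2
    rw [Matrix.det_fin_two, h10, mul_zero, sub_zero] at hdet
    exact hdet
  inv_val := by
    have hdet : ((b : G p) : Matrix (Fin 2) (Fin 2) (F p)).det = 1 := (b : G p).2
    have h10 : ((b : G p) : Matrix (Fin 2) (Fin 2) (F p)) 1 0 = 0 := b.2
    rw [Matrix.det_fin_two, h10, mul_zero, sub_zero] at hdet
    rw [mul_comm]; exact hdet

variable (k : Type) [Field k] [IsAlgClosed k] [CharZero k]

/-- The group algebra `kG`. -/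
abbrev kG : Type := MonoidAlgebra k (G p)

/-- The canonical image of a group element in the group algebra. -/
def γ (g : G p) : kG p k := MonoidAlgebra.of k (G p) g

/-- The submodule of relations defining the induced module
`M(θ) = kG ⊗_{kB} k_θ`, where the character `θ` of `T ≅ Fˣ` is extended to `B`
by letting `U` act trivially. -/
def Nmod (θ : (F p)ˣ →* kˣ) : Submodule (kG p k) (kG p k) :=
  Submodule.span (kG p k)
    {y | ∃ b : B p, y = γ p k (b : G p) - ((θ (Bdiag p b) : k)) • (1 : kG p k)}

/-- The induced module `M(θ) = kG ⊗_{kB} k_θ`, realized as `kG / N(θ)` where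
`N(θ)` is the left submodule generated by the elements `b - θ(b)·1`, `b ∈ B`. -/
def Mmod (θ : (F p)ˣ →* kˣ) : Type := kG p k ⧸ Nmod p k θ

instance (θ : (F p)ˣ →* kˣ) : AddCommGroup (Mmod p k θ) :=
  inferInstanceAs (AddCommGroup (kG p k ⧸ Nmod p k θ))
instance (θ : (F p)ˣ →* kˣ) : Module (kG p k) (Mmod p k θ) :=
  inferInstanceAs (Module (kG p k) (kG p k ⧸ Nmod p k θ))
instance (θ : (F p)ˣ →* kˣ) : Module k (Mmod p k θ) :=
  inferInstanceAs (Module k (kG p k ⧸ Nmod p k θ))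
instance (θ : (F p)ˣ →* kˣ) : IsScalarTower k (kG p k) (Mmod p k θ) :=
  inferInstanceAs (IsScalarTower k (kG p k) (kG p k ⧸ Nmod p k θ))

/-- The canonical generator `1_θ ∈ M(θ)`. -/
def oneθ (θ : (F p)ˣ →* kˣ) : Mmod p k θ :=
  Submodule.Quotient.mk (1 : kG p k)

/-- `η = (1 - s)·1_tr ∈ M(tr)`. -/
def eta : Mmod p k 1 :=
  Submodule.Quotient.mk ((1 : kG p k) - γ p k (sG p))

/-- The Steinberg module `St = kG·η ⊆ M(tr)`. -/
def St : Submodule (kG p k) (Mmod p k 1) :=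
  Submodule.span (kG p k) {eta p k}

/-- `ε(x)·η` as an element of `St`. -/
def E (x : F p) : ↥(St p k) :=
  ⟨γ p k (eps p x) • eta p k,
    Submodule.smul_mem _ _ (Submodule.mem_span_singleton_self _)⟩

/-- The action of a group element on `St`, as a `k`-linear map. -/
def gSt (g : G p) : ↥(St p k) →ₗ[k] ↥(St p k) where
  toFun v := ⟨γ p k g • (v : Mmod p k 1), Submodule.smul_mem _ _ v.2⟩
  map_add' := by intro a b; apply Subtype.ext; simp [smul_add]
  map_smul' := by
    intro c v; apply Subtype.ext
    simp [smul_comm (γ p k g) c]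

/-- `St ⊗_k St`. -/
abbrev StT : Type := ↥(St p k) ⊗[k] ↥(St p k)

/-- The diagonal action of a group element on `St ⊗_k St`. -/
def gTT (g : G p) : StT p k →ₗ[k] StT p k :=
  TensorProduct.map (gSt p k g) (gSt p k g)

/-- `ω_{x,y} = (ε(x)η ⊗ ε(y)η + ε(y)η ⊗ ε(x)η)/2`. -/
def ω (x y : F p) : StT p k :=
  (2 : k)⁻¹ • (E p k x ⊗ₜ[k] E p k y + E p k y ⊗ₜ[k] E p k x)

/-- `ρ_{x,y} = (ε(x)η ⊗ ε(y)η − ε(y)η ⊗ ε(x)η)/2`. -/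
def ρ (x y : F p) : StT p k :=
  (2 : k)⁻¹ • (E p k x ⊗ₜ[k] E p k y - E p k y ⊗ₜ[k] E p k x)

/-- `V₊`, the span of the `ω_{x,y}`. -/
def Vplus : Submodule k (StT p k) :=
  Submodule.span k {v | ∃ x y : F p, v = ω p k x y}

/-- `V₋`, the span of the `ρ_{x,y}` for `x ≠ y`. -/
def Vminus : Submodule k (StT p k) :=
  Submodule.span k {v | ∃ x y : F p, x ≠ y ∧ v = ρ p k x y}


theorem add_tmul_comm_mem_iff {R M : Type*} [CommRing R] [AddCommGroup M] [Module R M]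
    {W : Submodule R (M ⊗[R] M)} {v w : M} (hv : v ⊗ₜ[R] v ∈ W) (hw : w ⊗ₜ[R] w ∈ W) :
    v ⊗ₜ[R] w + w ⊗ₜ[R] v ∈ W ↔ (w - v) ⊗ₜ[R] (w - v) ∈ W := by
  have heq : (w - v) ⊗ₜ[R] (w - v) =
      v ⊗ₜ[R] v + w ⊗ₜ[R] w - (v ⊗ₜ[R] w + w ⊗ₜ[R] v) := by
    simp only [TensorProduct.sub_tmul, TensorProduct.tmul_sub]
    abel
  rw [heq, W.sub_mem_iff_right (W.add_mem hv hw)]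

/-- The point `g·1_tr` of `M(tr)`. -/
def point (g : G p) : Mmod p k 1 := Submodule.Quotient.mk (γ p k g)

theorem γ_mul (g g' : G p) : γ p k (g * g') = γ p k g * γ p k g' :=
  map_mul (MonoidAlgebra.of k (G p)) g g'

theorem point_mul_mem_B (g : G p) {b : G p} (hb : b ∈ B p) :
    point p k (g * b) = point p k g := by
  refine (Submodule.Quotient.eq (Nmod p k 1)).2 ?_
  have hmem : γ p k b - (1 : kG p k) ∈ Nmod p k 1 :=
    Submodule.subset_span ⟨⟨b, hb⟩, by simp⟩
  have := (Nmod p k 1).smul_mem (γ p k g) hmem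
  rwa [smul_eq_mul, mul_sub, mul_one, ← γ_mul] at this

theorem point_eq_of_inv_mul_mem_B {g g' : G p} (hg : g'⁻¹ * g ∈ B p) :
    point p k g = point p k g' := by
  rw [← point_mul_mem_B p k g' hg, mul_inv_cancel_left]

theorem smul_eta (g : G p) :
    γ p k g • eta p k = point p k g - point p k (g * sG p) := by
  change (Submodule.Quotient.mk (γ p k g • ((1 : kG p k) - γ p k (sG p))) :
    kG p k ⧸ Nmod p k 1) = Submodule.Quotient.mk (γ p k g - γ p k (g * sG p))
  rw [smul_eq_mul, mul_sub, mul_one, γ_mul]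

theorem coe_E (x : F p) :
    (E p k x : Mmod p k 1) = point p k 1 - point p k (eps p x * sG p) := by
  have hx : eps p x ∈ B p := by
    change (eps p x : Matrix (Fin 2) (Fin 2) (F p)) 1 0 = 0
    simp [eps]
  rw [← point_mul_mem_B p k 1 hx, one_mul]
  exact smul_eta p k (eps p x)

theorem eps_zero : eps p 0 = 1 := by
  ext i j
  fin_cases i <;> fin_cases j <;> simp [eps]

theorem gSt_E_zero (g : G p) :
    (gSt p k g (E p k 0) : Mmod p k 1) = point p k g - point p k (g * sG p) := by
  change γ p k g • (γ p k (eps p 0) • eta p k) = _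
  rw [smul_smul, ← γ_mul, eps_zero, mul_one, smul_eta]

theorem point_eq_affine (g : G p) (x : F p)
    (hx : (g : Matrix (Fin 2) (Fin 2) (F p)) 0 0 =
      x * (g : Matrix (Fin 2) (Fin 2) (F p)) 1 0) :
    point p k g = point p k (eps p x * sG p) := by
  apply point_eq_of_inv_mul_mem_B
  change (((eps p x * sG p)⁻¹ * g : G p) : Matrix (Fin 2) (Fin 2) (F p)) 1 0 = 0
  have hmul : ((eps p x * sG p : G p) : Matrix (Fin 2) (Fin 2) (F p)) = !![-x, 1; -1, 0] := by
    rw [Matrix.SpecialLinearGroup.coe_mul]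
    simp [eps, sG]
  rw [Matrix.SpecialLinearGroup.coe_mul, Matrix.SpecialLinearGroup.coe_inv, hmul]
  simp [Matrix.adjugate_fin_two, Matrix.mul_apply, Fin.sum_univ_two, hx]

theorem exists_point_eq (g : G p) :
    ∃ v : St p k, (v = 0 ∨ ∃ x, v = E p k x) ∧ point p k g = point p k 1 - v := by
  by_cases hg : (g : Matrix (Fin 2) (Fin 2) (F p)) 1 0 = 0
  · refine ⟨0, Or.inl rfl, ?_⟩
    rw [← point_mul_mem_B p k 1 (b := g) hg]
    simp
  · refine ⟨E p k ((g : Matrix (Fin 2) (Fin 2) (F p)) 0 0 /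
      (g : Matrix (Fin 2) (Fin 2) (F p)) 1 0), Or.inr ⟨_, rfl⟩, ?_⟩
    rw [coe_E, sub_sub_cancel]
    exact point_eq_affine p k g _ (div_mul_cancel₀ _ hg).symm

theorem exists_gSt_E_zero_eq_sub {x y : F p} (hxy : x ≠ y) :
    ∃ g : G p, gSt p k g (E p k 0) = E p k y - E p k x := by
  have hc : x - y ≠ 0 := sub_ne_zero.2 hxy
  have hdet : Matrix.det !![x * (x - y)⁻¹, y; (x - y)⁻¹, 1] = 1 := by
    rw [Matrix.det_fin_two_of, mul_one, ← sub_mul, mul_inv_cancel₀ hc]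
  let g : G p := ⟨!![x * (x - y)⁻¹, y; (x - y)⁻¹, 1], hdet⟩
  have hx : point p k g = point p k (eps p x * sG p) :=
    point_eq_affine p k g x (by simp [g])
  have hy : point p k (g * sG p) = point p k (eps p y * sG p) :=
    point_eq_affine p k _ y (by
      rw [Matrix.SpecialLinearGroup.coe_mul]
      simp [g, sG, Matrix.mul_apply, Fin.sum_univ_two])
  refine ⟨g, Subtype.ext ?_⟩
  rw [gSt_E_zero, AddSubgroupClass.coe_sub, coe_E, coe_E, sub_sub_sub_cancel_left, hx, hy]

theorem ω_self (x : F p) : ω p k x x = E p k x ⊗ₜ[k] E p k x := by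
  rw [ω, ← two_smul k, smul_smul, inv_mul_cancel₀ two_ne_zero, one_smul]

theorem gTT_ω_zero (g : G p) :
    gTT p k g (ω p k 0 0) = gSt p k g (E p k 0) ⊗ₜ[k] gSt p k g (E p k 0) := by
  rw [ω_self, gTT, TensorProduct.map_tmul]

theorem add_tmul_comm_mem_Vplus {v w : St p k} (hv : v = 0 ∨ ∃ x, v = E p k x)
    (hw : w = 0 ∨ ∃ x, w = E p k x) : v ⊗ₜ[k] w + w ⊗ₜ[k] v ∈ Vplus p k := by
  obtain rfl | ⟨x, rfl⟩ := hv
  · simp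
  obtain rfl | ⟨y, rfl⟩ := hw
  · simp
  have := (Vplus p k).smul_mem (2 : k) (Submodule.subset_span ⟨x, y, rfl⟩)
  rwa [ω, smul_smul, mul_inv_cancel₀ two_ne_zero, one_smul] at this

theorem tmul_self_mem_Vplus {v : St p k} (hv : v = 0 ∨ ∃ x, v = E p k x) :
    v ⊗ₜ[k] v ∈ Vplus p k := by
  obtain rfl | ⟨x, rfl⟩ := hv
  · simp
  · exact Submodule.subset_span ⟨x, x, (ω_self p k x).symm⟩

/-- `V₊ = kG·ω_{0,0}`, i.e. `V₊` is the `k`-span of the `G`-orbit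
of `ω_{0,0}`. -/
theorem stmt5 (hp2 : p ≠ 2) :
    Vplus p k = Submodule.span k {v : StT p k | ∃ g : G p, v = gTT p k g (ω p k 0 0)} := by
  apply le_antisymm
  · refine Submodule.span_le.2 ?_
    rintro _ ⟨x, y, rfl⟩
    set W := Submodule.span k {v : StT p k | ∃ g : G p, v = gTT p k g (ω p k 0 0)} with hW
    have hsq (g : G p) : gSt p k g (E p k 0) ⊗ₜ[k] gSt p k g (E p k 0) ∈ W :=
      Submodule.subset_span ⟨g, (gTT_ω_zero p k g).symm⟩
    have hE (z : F p) : E p k z ⊗ₜ[k] E p k z ∈ W := by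
      have hz : gSt p k (eps p z) (E p k 0) = E p k z := by
        apply Subtype.ext
        rw [gSt_E_zero, ← smul_eta]
        rfl
      simpa only [hz] using hsq (eps p z)
    by_cases hxy : x = y
    · subst hxy
      rw [ω_self]
      exact hE x
    · obtain ⟨g, hg⟩ := exists_gSt_E_zero_eq_sub p k hxy
      have hd := hsq g
      rw [hg] at hd
      exact W.smul_mem _ ((add_tmul_comm_mem_iff (hE x) (hE y)).2 hd)
  · refine Submodule.span_le.2 ?_
    rintro _ ⟨g, rfl⟩
    obtain ⟨v, hv, hgv⟩ := exists_point_eq p k g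
    obtain ⟨w, hw, hgw⟩ := exists_point_eq p k (g * sG p)
    have hg : gSt p k g (E p k 0) = w - v := by
      apply Subtype.ext
      rw [gSt_E_zero, hgv, hgw, AddSubgroupClass.coe_sub, sub_sub_sub_cancel_left]
    rw [SetLike.mem_coe, gTT_ω_zero, hg]
    exact (add_tmul_comm_mem_iff (tmul_self_mem_Vplus p k hv) (tmul_self_mem_Vplus p k hw)).1
      (add_tmul_comm_mem_Vplus p k hv hw)

end SL2X
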